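/- Let a be an ideal of R, M a weakly Laskerian R-module, and t ≥ 0 an integer such that H_a^i(M) is weakly Laskerian for all i < t. Then Ass_R(H_a^t(M)) and Ass_R(Ext_R^1(R/a, H_a^t(M))) are finite sets. -/

import Mathlib

open CategoryTheory

/-- An `R`-module `M` is weakly Laskerian if every quotient of `M`
has finitely many associated primes. -/
def WeaklyLaskerian (R M : Type*) [CommRing R] [AddCommGroup M] [Module R M] : Prop :=
  ∀ N : Submodule R M, (associatedPrimes R (M ⧸ N)).Finite

/-- `Ext_R^j(R/a, N)` for a module `N` in `ModuleCat R`. -/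
noncomputable def extMod {R : Type} [CommRing R] (a : Ideal R) (j : ℕ)
    (N : ModuleCat.{0} R) : ModuleCat.{0} R :=
  ((Ext R (ModuleCat.{0} R) j).obj (Opposite.op (ModuleCat.of R (R ⧸ a)))).obj N

/-- Descend a linear map along a surjective linear map. -/
noncomputable def LinearMap.descend {R A E Q : Type*} [CommRing R] [AddCommGroup A] [AddCommGroup E]
    [AddCommGroup Q] [Module R A] [Module R E] [Module R Q] (s : A →ₗ[R] E)
    (hs : Function.Surjective s) (q : A →ₗ[R] Q) (h : LinearMap.ker s ≤ LinearMap.ker q) :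
    E →ₗ[R] Q :=
  (LinearMap.ker s).liftQ q h ∘ₗ (s.quotKerEquivOfSurjective hs).symm.toLinearMap

@[simp]
lemma LinearMap.descend_apply {R A E Q : Type*} [CommRing R] [AddCommGroup A] [AddCommGroup E]
    [AddCommGroup Q] [Module R A] [Module R E] [Module R Q] (s : A →ₗ[R] E)
    (hs : Function.Surjective s) (q : A →ₗ[R] Q) (h : LinearMap.ker s ≤ LinearMap.ker q) (a : A) :
    s.descend hs q h (s a) = q a := by
  have : (s.quotKerEquivOfSurjective hs).symm (s a) = (LinearMap.ker s).mkQ a := by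
    rw [LinearEquiv.symm_apply_eq]; rfl
  simp [LinearMap.descend, this]

namespace CategoryTheory.ProjectiveResolution

open Limits Opposite

variable {R : Type} [CommRing R] {X : ModuleCat.{0} R} (P : ProjectiveResolution X)
  (Y : ModuleCat.{0} R)

/-- The complex computing `Ext X Y` by the left derived functors of `Hom(-, Y)`. -/
noncomputable abbrev homComplex : ChainComplex (ModuleCat.{0} R)ᵒᵖ ℕ :=
  (((linearYoneda R (ModuleCat.{0} R)).obj Y).rightOp.mapHomologicalComplex _).obj P.complex

/-- The module of degree `n` cocycles of `Hom(P, Y)`. -/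
noncomputable abbrev homCocycles (n : ℕ) : ModuleCat.{0} R := ((P.homComplex Y).opcycles n).unop

/-- Underlying morphism of a cocycle of `Hom(P, Y)`. -/
noncomputable def homCocyclesι (n : ℕ) : P.homCocycles Y n →ₗ[R] (P.complex.X n ⟶ Y) :=
  ((P.homComplex Y).pOpcycles n).unop.hom

/-- The homology of `Hom(P, Y)` is the left derived functor of `Hom(-, Y)`. -/
noncomputable def homComplexHomologyIso (n : ℕ) : ((P.homComplex Y).homology n).unop ≅
    ((Ext R (ModuleCat.{0} R) n).obj (op X)).obj Y :=
  (P.isoLeftDerivedObj ((linearYoneda R (ModuleCat.{0} R)).obj Y).rightOp n).unop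

/-- The class of a cocycle of `Hom(P, Y)` in the left derived functor of `Hom(-, Y)`. -/
noncomputable def homCocyclesToExt (n : ℕ) :
    P.homCocycles Y n ⟶ ((Ext R (ModuleCat.{0} R) n).obj (op X)).obj Y :=
  ((P.homComplex Y).homologyι n).unop ≫ (P.homComplexHomologyIso Y n).hom

lemma d_comp_homCocyclesι (n m : ℕ) (c : P.homCocycles Y n) :
    P.complex.d m n ≫ P.homCocyclesι Y n c = 0 := by
  have := congrArg Quiver.Hom.unop ((P.homComplex Y).d_pOpcycles m n)
  exact congr($(this).hom c)

lemma homCocyclesι_injective (n : ℕ) : Function.Injective (P.homCocyclesι Y n) := by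
  have : Mono ((P.homComplex Y).pOpcycles n).unop := inferInstance
  exact (ModuleCat.mono_iff_injective _).1 this

lemma exists_homCocycles (n m : ℕ) (hm : n + 1 = m) (f : P.complex.X n ⟶ Y)
    (hf : P.complex.d m n ≫ f = 0) : ∃ c, P.homCocyclesι Y n c = f := by
  have hprev : (ComplexShape.down ℕ).prev n = m := by simp [hm]
  let k : (ModuleCat.of R R) ⟶ ((P.homComplex Y).X n).unop :=
    ModuleCat.ofHom (LinearMap.toSpanSingleton R _ f)
  have hk : (P.homComplex Y).d m n ≫ k.op = 0 := by
    apply Quiver.Hom.unop_inj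
    ext
    change P.complex.d m n ≫ ((1 : R) • f) = 0
    simp [hf]
  refine ⟨((P.homComplex Y).descOpcycles k.op m hprev hk).unop.hom 1, ?_⟩
  have := congrArg Quiver.Hom.unop ((P.homComplex Y).p_descOpcycles k.op m hprev hk)
  refine congr($(this).hom (1 : R)).trans ?_
  exact one_smul R f

lemma homCocyclesToExt_surjective (n : ℕ) : Function.Surjective (P.homCocyclesToExt Y n) := by
  rw [← ModuleCat.epi_iff_surjective]
  have : Epi ((P.homComplex Y).homologyι n).unop := inferInstance
  exact epi_comp _ _

lemma homCocyclesToExt_eq_zero_iff (n : ℕ) (c : P.homCocycles Y n) :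
    P.homCocyclesToExt Y n c = 0 ↔
      ∃ g : P.complex.X ((ComplexShape.down ℕ).next n) ⟶ Y,
        P.complex.d n _ ≫ g = P.homCocyclesι Y n c := by
  set j := (ComplexShape.down ℕ).next n with hj
  let K := P.homComplex Y
  have hex := (ShortComplex.exact_of_f_is_kernel
    (ShortComplex.mk _ _ (K.homologyι_comp_fromOpcycles n j))
    (K.homologyIsKernel n j hj.symm)).unop
  rw [ShortComplex.moduleCat_exact_iff] at hex
  have hd (g : P.complex.X j ⟶ Y) :
      P.homCocyclesι Y n ((K.fromOpcycles n j).unop.hom g) = P.complex.d n j ≫ g :=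
    congr($(congrArg Quiver.Hom.unop (K.p_fromOpcycles n j)).hom g)
  have hinj : Function.Injective (P.homComplexHomologyIso Y n).hom :=
    (ModuleCat.mono_iff_injective _).1 inferInstance
  constructor
  · intro h
    have h' : (K.homologyι n).unop.hom c = 0 :=
      hinj (h.trans (map_zero (P.homComplexHomologyIso Y n).hom.hom).symm)
    obtain ⟨g, hg⟩ := hex c h'
    exact ⟨g, (hd g).symm.trans (congrArg _ hg)⟩
  · rintro ⟨g, hg⟩
    have hc : c = (K.fromOpcycles n j).unop.hom g :=
      P.homCocyclesι_injective Y n (hg.symm.trans (hd g).symm)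
    have h0 : (K.homologyι n).unop.hom c = 0 := by
      rw [hc]
      exact congr($(congrArg Quiver.Hom.unop (K.homologyι_comp_fromOpcycles n j)).hom g)
    exact (congrArg (P.homComplexHomologyIso Y n).hom.hom h0).trans (map_zero _)

lemma homCocyclesToExt_naturality {X' : ModuleCat.{0} R} (P' : ProjectiveResolution X')
    (f : X' ⟶ X) (φ : Hom P' P f) (n : ℕ) (c : P.homCocycles Y n) :
    ∃ c' : P'.homCocycles Y n, P'.homCocyclesι Y n c' = φ.hom.f n ≫ P.homCocyclesι Y n c ∧
      P'.homCocyclesToExt Y n c' =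
        (((Ext R (ModuleCat.{0} R) n).map f.op).app Y) (P.homCocyclesToExt Y n c) := by
  let F := ((linearYoneda R (ModuleCat.{0} R)).obj Y).rightOp
  let ψ : P'.homComplex Y ⟶ P.homComplex Y := (F.mapHomologicalComplex _).map φ.hom
  refine ⟨(HomologicalComplex.opcyclesMap ψ n).unop.hom c, ?_, ?_⟩
  · exact congr($(congrArg Quiver.Hom.unop (HomologicalComplex.p_opcyclesMap ψ n)).hom c)
  · have h1 := HomologicalComplex.homologyι_naturality ψ n
    have hφ : φ.hom.f 0 ≫ P.π.f 0 = P'.π.f 0 ≫ f := φ.hom_f_zero_comp_π_f_zero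
    have h2 : (F.leftDerived n).map f ≫ (P.isoLeftDerivedObj F n).hom =
        (P'.isoLeftDerivedObj F n).hom ≫ HomologicalComplex.homologyMap ψ n :=
      isoLeftDerivedObj_hom_naturality f P' P φ.hom hφ F n
    have e1 := congr($(congrArg Quiver.Hom.unop h1).hom c)
    have e2 := congr($(congrArg Quiver.Hom.unop h2).hom
      (((P.homComplex Y).homologyι n).unop.hom c))
    exact (congrArg (P'.isoLeftDerivedObj F n).hom.unop.hom e1.symm).trans e2.symm
variable {Y} in
lemma smul_extMk {n : ℕ} (r : R) (f : P.complex.X n ⟶ Y) (m : ℕ) (hm : n + 1 = m)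
    (hf : P.complex.d m n ≫ f = 0) :
    r • P.extMk f m hm hf = P.extMk (r • f) m hm (by simp [hf]) := by
  rw [Abelian.Ext.smul_eq_comp_mk₀, extMk_comp_mk₀]
  congr 1

variable {Y} in
lemma extMk_zero_eq_zero_iff (f : P.complex.X 0 ⟶ Y) (m : ℕ) (hm : 0 + 1 = m)
    (hf : P.complex.d m 0 ≫ f = 0) : P.extMk f m hm hf = 0 ↔ f = 0 := by
  constructor
  swap
  · rintro rfl; simp
  rw [← P.extEquivCohomologyClass.apply_eq_iff_eq,
    extEquivCohomologyClass_extMk, extEquivCohomologyClass_zero,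
    CochainComplex.HomComplex.CohomologyClass.mk_eq_zero_iff,
    CochainComplex.HomComplex.Cocycle.toSingleMk_mem_coboundaries_iff _ _ _ _ _ 1 (by lia)]
  rintro ⟨g, hg⟩
  have hz : IsZero (P.cochainComplex.X 1) := CochainComplex.isZero_of_isStrictlyLE _ 0 _
  rw [hz.eq_of_src g 0, comp_zero, eq_comm] at hg
  rw [← cancel_epi (P.cochainComplexXIso (-((0 : ℕ) : ℤ)) 0 rfl).hom, comp_zero]
  exact hg

variable {Y} in
lemma extMk_eq_zero_iff_next {n : ℕ} (f : P.complex.X n ⟶ Y) (m : ℕ) (hm : n + 1 = m)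
    (hf : P.complex.d m n ≫ f = 0) :
    P.extMk f m hm hf = 0 ↔ ∃ g : P.complex.X ((ComplexShape.down ℕ).next n) ⟶ Y,
        P.complex.d n _ ≫ g = f := by
  cases n with
  | zero =>
    rw [extMk_zero_eq_zero_iff, P.complex.shape _ _ (by simp)]
    simp [eq_comm]
  | succ n =>
    rw [ChainComplex.next_nat_succ]
    exact P.extMk_eq_zero_iff f m hm hf n rfl

/-- The class of a cocycle of `Hom(P, Y)` in `Abelian.Ext`. -/
noncomputable def homCocyclesToAbelianExt (n : ℕ) :
    P.homCocycles Y n →ₗ[R] Abelian.Ext X Y n where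
  toFun c := P.extMk (P.homCocyclesι Y n c) _ rfl (P.d_comp_homCocyclesι Y n _ c)
  map_add' c c' := by simp [add_extMk]
  map_smul' r c := by simp [smul_extMk]

lemma homCocyclesToAbelianExt_apply (n : ℕ) (c : P.homCocycles Y n) :
    P.homCocyclesToAbelianExt Y n c =
      P.extMk (P.homCocyclesι Y n c) _ rfl (P.d_comp_homCocyclesι Y n _ c) := rfl

lemma homCocyclesToAbelianExt_surjective (n : ℕ) :
    Function.Surjective (P.homCocyclesToAbelianExt Y n) := by
  intro e
  obtain ⟨f, hf, rfl⟩ := P.extMk_surjective e _ rfl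
  obtain ⟨c, rfl⟩ := P.exists_homCocycles Y n _ rfl f hf
  exact ⟨c, rfl⟩

lemma ker_homCocyclesToAbelianExt (n : ℕ) :
    LinearMap.ker (P.homCocyclesToAbelianExt Y n) = LinearMap.ker (P.homCocyclesToExt Y n).hom := by
  ext c
  refine (P.extMk_eq_zero_iff_next (P.homCocyclesι Y n c) _ rfl
    (P.d_comp_homCocyclesι Y n _ c)).trans (P.homCocyclesToExt_eq_zero_iff Y n c).symm

/-- Comparison of the two definitions of `Ext`. -/
noncomputable def extLinearEquiv (n : ℕ) :
    ((Ext R (ModuleCat.{0} R) n).obj (op X)).obj Y ≃ₗ[R] Abelian.Ext X Y n :=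
  ((P.homCocyclesToExt Y n).hom.quotKerEquivOfSurjective
    (P.homCocyclesToExt_surjective Y n)).symm.trans
  ((Submodule.quotEquivOfEq _ _ (P.ker_homCocyclesToAbelianExt Y n).symm).trans
    ((P.homCocyclesToAbelianExt Y n).quotKerEquivOfSurjective
      (P.homCocyclesToAbelianExt_surjective Y n)))

lemma extLinearEquiv_homCocyclesToExt (n : ℕ) (c : P.homCocycles Y n) :
    P.extLinearEquiv Y n (P.homCocyclesToExt Y n c) = P.homCocyclesToAbelianExt Y n c := by
  have : ((P.homCocyclesToExt Y n).hom.quotKerEquivOfSurjective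
      (P.homCocyclesToExt_surjective Y n)).symm (P.homCocyclesToExt Y n c) =
      (LinearMap.ker _).mkQ c := by
    rw [LinearEquiv.symm_apply_eq]; rfl
  simp only [extLinearEquiv, LinearEquiv.trans_apply]
  rw [this]
  rfl

lemma extLinearEquiv_naturality {X' : ModuleCat.{0} R} (P' : ProjectiveResolution X')
    (f : X' ⟶ X) (n : ℕ) (e : ((Ext R (ModuleCat.{0} R) n).obj (op X)).obj Y) :
    P'.extLinearEquiv Y n ((((Ext R (ModuleCat.{0} R) n).map f.op).app Y) e) =
      (Abelian.Ext.mk₀ f).comp (P.extLinearEquiv Y n e) (zero_add n) := by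
  obtain ⟨c, rfl⟩ := P.homCocyclesToExt_surjective Y n e
  let φ : Hom P' P f := ⟨lift f P' P, lift_commutes_zero f P' P⟩
  obtain ⟨c', h1, h2⟩ := P.homCocyclesToExt_naturality Y P' f φ n c
  rw [← h2, extLinearEquiv_homCocyclesToExt, extLinearEquiv_homCocyclesToExt,
    homCocyclesToAbelianExt_apply, homCocyclesToAbelianExt_apply, mk₀_comp_extMk _ _ _ _ φ]
  congr 1

end CategoryTheory.ProjectiveResolution

namespace CategoryTheory.InjectiveResolution

open Limits

variable {R : Type} [CommRing R] {X Y : ModuleCat.{0} R} (I : InjectiveResolution Y)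

lemma smul_extMk {n : ℕ} (r : R) (f : X ⟶ I.cocomplex.X n) (m : ℕ) (hm : n + 1 = m)
    (hf : f ≫ I.cocomplex.d n m = 0) :
    r • I.extMk f m hm hf = I.extMk (r • f) m hm (by simp [hf]) := by
  have : I.extMk (r • f) m hm (by simp [hf]) = I.extMk ((r • 𝟙 X) ≫ f) m hm (by simp [hf]) := by
    congr 1
    simp
  rw [this, ← mk₀_comp_extMk _ _ _ _ hf, Abelian.Ext.mk₀_smul, Abelian.Ext.smul_comp,
    Abelian.Ext.mk₀_id_comp]

lemma extMk_zero_eq_zero_iff (f : X ⟶ I.cocomplex.X 0) (m : ℕ) (hm : 0 + 1 = m)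
    (hf : f ≫ I.cocomplex.d 0 m = 0) : I.extMk f m hm hf = 0 ↔ f = 0 := by
  constructor
  swap
  · rintro rfl; simp
  rw [← I.extEquivCohomologyClass.apply_eq_iff_eq,
    extEquivCohomologyClass_extMk, extEquivCohomologyClass_zero,
    CochainComplex.HomComplex.CohomologyClass.mk_eq_zero_iff,
    CochainComplex.HomComplex.Cocycle.fromSingleMk_mem_coboundaries_iff _ _ _ _ _ (-1) (by lia)]
  rintro ⟨g, hg⟩
  have hz : IsZero (I.cochainComplex.X (-1)) := CochainComplex.isZero_of_isStrictlyGE _ 0 _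
  rw [hz.eq_of_tgt g 0, zero_comp, eq_comm] at hg
  rw [← cancel_mono (I.cochainComplexXIso ((0 : ℕ) : ℤ) 0 rfl).inv, zero_comp]
  exact hg

end CategoryTheory.InjectiveResolution

/-- The submodule `Γ_a(N)` of elements killed by a power of `a`. -/
def Ideal.powTorsion {R : Type*} [CommRing R] (a : Ideal R) (N : Type*) [AddCommGroup N]
    [Module R N] : Submodule R N where
  carrier := {x | ∃ k, ∀ r ∈ a ^ k, r • x = 0}
  zero_mem' := ⟨0, by simp⟩
  add_mem' := by
    rintro x y ⟨k, hk⟩ ⟨l, hl⟩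
    refine ⟨max k l, fun r hr => ?_⟩
    rw [smul_add, hk r (Ideal.pow_le_pow_right (le_max_left k l) hr),
      hl r (Ideal.pow_le_pow_right (le_max_right k l) hr), add_zero]
  smul_mem' := by
    rintro c x ⟨k, hk⟩
    exact ⟨k, fun r hr => by rw [smul_comm, hk r hr, smul_zero]⟩

lemma Ideal.mem_powTorsion {R : Type*} [CommRing R] {a : Ideal R} {N : Type*} [AddCommGroup N]
    [Module R N] {x : N} : x ∈ a.powTorsion N ↔ ∃ k, ∀ r ∈ a ^ k, r • x = 0 := Iff.rfl

lemma Ideal.map_mem_powTorsion {R : Type*} [CommRing R] {a : Ideal R} {N N' : Type*}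
    [AddCommGroup N] [Module R N] [AddCommGroup N'] [Module R N'] (f : N →ₗ[R] N') {x : N}
    (hx : x ∈ a.powTorsion N) : f x ∈ a.powTorsion N' := by
  obtain ⟨k, hk⟩ := hx
  exact ⟨k, fun r hr => by rw [← map_smul, hk r hr, map_zero]⟩

/-- Every linear map out of `R ⧸ J` has image in the `a`-power torsion if `a ^ k ≤ J`. -/
lemma Ideal.map_quotient_mem_powTorsion {R : Type*} [CommRing R] {a J : Ideal R} {N : Type*}
    [AddCommGroup N] [Module R N] {k : ℕ} (h : a ^ k ≤ J) (f : (R ⧸ J) →ₗ[R] N) (x : R ⧸ J) :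
    f x ∈ a.powTorsion N := by
  refine Ideal.map_mem_powTorsion f ⟨k, fun r hr => ?_⟩
  obtain ⟨x, rfl⟩ := Ideal.Quotient.mk_surjective x
  rw [Algebra.smul_def, Ideal.Quotient.algebraMap_eq, Ideal.Quotient.eq_zero_iff_mem.2 (h hr),
    zero_mul]

/-- The linear map `R ⧸ J → N` with value `x` at `1`. -/
def Ideal.quotientToSpanSingleton {R N : Type*} [CommRing R] [AddCommGroup N] [Module R N]
    (J : Ideal R) (x : N) (h : ∀ r ∈ J, r • x = 0) : (R ⧸ J) →ₗ[R] N :=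
  J.liftQ (LinearMap.toSpanSingleton R N x) h

lemma Ideal.quotientToSpanSingleton_one {R N : Type*} [CommRing R] [AddCommGroup N]
    [Module R N] (J : Ideal R) (x : N) (h : ∀ r ∈ J, r • x = 0) :
    J.quotientToSpanSingleton x h 1 = x :=
  one_smul R x

lemma Ideal.quotient_linearMap_ext {R N : Type*} [CommRing R] [AddCommGroup N]
    [Module R N] {J : Ideal R} {f g : (R ⧸ J) →ₗ[R] N} (h : f 1 = g 1) : f = g := by
  refine Submodule.linearMap_qext _ (LinearMap.ext_ring h)

namespace CategoryTheory.InjectiveResolution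

open Limits Opposite

variable {R : Type} [CommRing R] {X Y : ModuleCat.{0} R} (I : InjectiveResolution Y)
  (a : Ideal R)

lemma extMk_eq_zero_iff_prev {n : ℕ} (f : X ⟶ I.cocomplex.X n) (m : ℕ) (hm : n + 1 = m)
    (hf : f ≫ I.cocomplex.d n m = 0) :
    I.extMk f m hm hf = 0 ↔ ∃ g : X ⟶ I.cocomplex.X ((ComplexShape.up ℕ).prev n),
        g ≫ I.cocomplex.d _ n = f := by
  cases n with
  | zero =>
    rw [extMk_zero_eq_zero_iff, I.cocomplex.shape _ _ (by simp)]
    simp [eq_comm]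
  | succ n =>
    rw [CochainComplex.prev_nat_succ]
    exact I.extMk_eq_zero_iff f m hm hf n rfl

/-- The cocycles of `Hom(X, I)`. -/
def homCocycles (X : ModuleCat.{0} R) (n : ℕ) : Submodule R (X ⟶ I.cocomplex.X n) :=
  LinearMap.ker (Linear.rightComp R X (I.cocomplex.d n (n + 1)))

/-- The class of a cocycle in `Ext`. -/
noncomputable def homCocyclesToExt (X : ModuleCat.{0} R) (n : ℕ) :
    I.homCocycles X n →ₗ[R] Abelian.Ext X Y n where
  toFun f := I.extMk f.1 _ rfl f.2
  map_add' f g := (I.add_extMk f.1 g.1 _ rfl f.2 g.2).symm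
  map_smul' r f := (I.smul_extMk r f.1 _ rfl f.2).symm

lemma homCocyclesToExt_surjective (n : ℕ) : Function.Surjective (I.homCocyclesToExt X n) := by
  intro e
  obtain ⟨f, hf, rfl⟩ := I.extMk_surjective e _ rfl
  exact ⟨⟨f, hf⟩, rfl⟩

lemma homCocyclesToExt_eq_zero_iff {n : ℕ} (f : I.homCocycles X n) :
    I.homCocyclesToExt X n f = 0 ↔ ∃ g : X ⟶ I.cocomplex.X ((ComplexShape.up ℕ).prev n),
        g ≫ I.cocomplex.d _ n = f.1 :=
  I.extMk_eq_zero_iff_prev f.1 _ rfl f.2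

/-- The cocycles of `Γ_a(I)`. -/
def torsionCocycles (n : ℕ) : Submodule R (I.cocomplex.X n) :=
  a.powTorsion _ ⊓ LinearMap.ker (I.cocomplex.d n (n + 1)).hom

/-- The coboundaries of `Γ_a(I)`. -/
noncomputable def torsionCoboundaries (n : ℕ) : Submodule R (I.cocomplex.X n) :=
  (a.powTorsion (I.cocomplex.X ((ComplexShape.up ℕ).prev n))).map (I.cocomplex.d _ n).hom

lemma torsionCoboundaries_le (n : ℕ) : I.torsionCoboundaries a n ≤ I.torsionCocycles a n := by
  rintro _ ⟨x, hx, rfl⟩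
  exact ⟨Ideal.map_mem_powTorsion _ hx, congr($(I.cocomplex.d_comp_d _ n (n + 1)).hom x)⟩

/-- The cohomology of `Γ_a(I)`. -/
abbrev torsionCohomology (n : ℕ) : Type :=
  I.torsionCocycles a n ⧸ (I.torsionCoboundaries a n).submoduleOf (I.torsionCocycles a n)

/-- Evaluation at `1` of a cocycle of `Hom(R ⧸ a ^ k, I)`. -/
def evalOneCocycles (k n : ℕ) :
    I.homCocycles (ModuleCat.of R (R ⧸ a ^ k)) n →ₗ[R] I.torsionCocycles a n where
  toFun f := ⟨f.1.hom (1 : R ⧸ a ^ k), Ideal.map_quotient_mem_powTorsion le_rfl f.1.hom _,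
    congr($(f.2).hom (1 : R ⧸ a ^ k))⟩
  map_add' _ _ := rfl
  map_smul' _ _ := rfl

/-- The map `Extⁿ(R ⧸ a ^ k, Y) → Hⁿ(Γ_a(I))` evaluating cocycles at `1`. -/
noncomputable def extToTorsionCohomology (k n : ℕ) :
    Abelian.Ext (ModuleCat.of R (R ⧸ a ^ k)) Y n →ₗ[R] I.torsionCohomology a n :=
  (I.homCocyclesToExt _ n).descend (I.homCocyclesToExt_surjective n)
    (Submodule.mkQ _ ∘ₗ I.evalOneCocycles a k n) (by
      intro f hf
      obtain ⟨g, hg⟩ := (I.homCocyclesToExt_eq_zero_iff f).1 hf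
      refine (Submodule.Quotient.mk_eq_zero _).2 ?_
      refine ⟨g.hom (1 : R ⧸ a ^ k), Ideal.map_quotient_mem_powTorsion le_rfl g.hom _, ?_⟩
      exact congr(($hg).hom (1 : R ⧸ a ^ k)))

lemma extToTorsionCohomology_apply (k n : ℕ) (f : I.homCocycles (ModuleCat.of R (R ⧸ a ^ k)) n) :
    I.extToTorsionCohomology a k n (I.homCocyclesToExt _ n f) =
      Submodule.Quotient.mk (I.evalOneCocycles a k n f) :=
  LinearMap.descend_apply _ _ _ _ _

lemma extToTorsionCohomology_exists_rep (n : ℕ) (x : I.torsionCohomology a n) :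
    ∃ k e, I.extToTorsionCohomology a k n e = x := by
  obtain ⟨⟨x, ⟨k, hk⟩, hx⟩, rfl⟩ := Submodule.Quotient.mk_surjective _ x
  refine ⟨k, I.homCocyclesToExt _ n
    ⟨ModuleCat.ofHom ((a ^ k).quotientToSpanSingleton x hk), ?_⟩, ?_⟩
  · refine ModuleCat.hom_ext (Ideal.quotient_linearMap_ext ?_)
    change (I.cocomplex.d n (n + 1)).hom ((a ^ k).quotientToSpanSingleton x hk 1) = 0
    rw [Ideal.quotientToSpanSingleton_one]
    exact hx
  · rw [extToTorsionCohomology_apply]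
    congr 1
    exact Subtype.ext (Ideal.quotientToSpanSingleton_one _ _ _)

/-- The projection `R ⧸ a ^ l → R ⧸ a ^ k` for `k ≤ l`. -/
def powProj {k l : ℕ} (h : k ≤ l) :
    ModuleCat.of R (R ⧸ a ^ l) ⟶ ModuleCat.of R (R ⧸ a ^ k) :=
  ModuleCat.ofHom (Submodule.mapQ (a ^ l) (a ^ k) LinearMap.id (Ideal.pow_le_pow_right h))

lemma extToTorsionCohomology_naturality {k l : ℕ} (h : k ≤ l) (n : ℕ)
    (e : Abelian.Ext (ModuleCat.of R (R ⧸ a ^ k)) Y n) :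
    I.extToTorsionCohomology a l n ((Abelian.Ext.mk₀ (powProj a h)).comp e (zero_add n)) =
      I.extToTorsionCohomology a k n e := by
  obtain ⟨f, rfl⟩ := I.homCocyclesToExt_surjective n e
  have : (Abelian.Ext.mk₀ (powProj a h)).comp (I.homCocyclesToExt _ n f) (zero_add n) =
      I.homCocyclesToExt _ n ⟨powProj a h ≫ f.1,
        (by simpa using congr(powProj a h ≫ $(f.2)) :
          (powProj a h ≫ f.1) ≫ I.cocomplex.d n (n + 1) = 0)⟩ :=
    I.mk₀_comp_extMk f.1 _ rfl f.2 (powProj a h)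
  rw [this, extToTorsionCohomology_apply, extToTorsionCohomology_apply]
  rfl

lemma extToTorsionCohomology_eq_zero {k n : ℕ}
    {e : Abelian.Ext (ModuleCat.of R (R ⧸ a ^ k)) Y n} (he : I.extToTorsionCohomology a k n e = 0) :
    ∃ l, ∃ h : k ≤ l, (Abelian.Ext.mk₀ (powProj a h)).comp e (zero_add n) = 0 := by
  obtain ⟨f, rfl⟩ := I.homCocyclesToExt_surjective n e
  rw [extToTorsionCohomology_apply, Submodule.Quotient.mk_eq_zero] at he
  obtain ⟨y, ⟨m, hm⟩, hy⟩ := he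
  have hm' : ∀ r ∈ a ^ (max k m), r • y = 0 := fun r hr =>
    hm r (Ideal.pow_le_pow_right (le_max_right k m) hr)
  refine ⟨max k m, le_max_left k m, (I.mk₀_comp_extMk f.1 _ rfl f.2 (powProj a _)).trans ?_⟩
  rw [extMk_eq_zero_iff_prev]
  refine ⟨ModuleCat.ofHom ((a ^ (max k m)).quotientToSpanSingleton y hm'), ?_⟩
  refine ModuleCat.hom_ext (Ideal.quotient_linearMap_ext ?_)
  change (I.cocomplex.d _ n).hom ((a ^ (max k m)).quotientToSpanSingleton y hm' 1) = _
  rw [Ideal.quotientToSpanSingleton_one]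
  exact hy

/-- The filtered system `Ext^n(R ⧸ a ^ k, Y)`. -/
noncomputable abbrev _root_.localCohomology.evaluatedDiagram (Y : ModuleCat.{0} R) (n : ℕ) :
    ℕᵒᵖᵒᵖ ⥤ ModuleCat.{0} R :=
  localCohomology.diagram (localCohomology.idealPowersDiagram a) n ⋙ (evaluation _ _).obj Y

/-- Local cohomology as a colimit of `Ext` modules. -/
noncomputable def _root_.localCohomology.evaluatedCocone (Y : ModuleCat.{0} R) (n : ℕ) :
    Cocone (localCohomology.evaluatedDiagram a Y n) :=
  ((evaluation _ _).obj Y).mapCocone (@colimit.cocone _ _ _ _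
    (localCohomology.diagram (localCohomology.idealPowersDiagram a) n)
    (localCohomology.hasColimitDiagram _ n))

/-- `localCohomology.evaluatedCocone` is a colimit cocone. -/
noncomputable def _root_.localCohomology.evaluatedCoconeIsColimit (Y : ModuleCat.{0} R) (n : ℕ) :
    IsColimit (localCohomology.evaluatedCocone a Y n) :=
  isColimitOfPreserves _ (colimit.isColimit _)

/-- `extToTorsionCohomology` on the `Ext` modules defining local cohomology. -/
noncomputable def extDiagramLeg (n k : ℕ) :
    ((Ext R (ModuleCat.{0} R) n).obj (op (ModuleCat.of R (R ⧸ a ^ k)))).obj Y →ₗ[R]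
      I.torsionCohomology a n :=
  I.extToTorsionCohomology a k n ∘ₗ
    ((projectiveResolution (ModuleCat.of R (R ⧸ a ^ k))).extLinearEquiv Y n).toLinearMap

/-- The cocone from `Extⁿ(R ⧸ a ^ k, Y)` to `Hⁿ(Γ_a(I))`. -/
noncomputable def torsionCocone (n : ℕ) : Cocone (localCohomology.evaluatedDiagram a Y n) where
  pt := ModuleCat.of R (I.torsionCohomology a n)
  ι :=
    { app := fun k => ModuleCat.ofHom (I.extDiagramLeg a n k.unop.unop)
      naturality := by
        intro k l f
        refine ModuleCat.hom_ext (LinearMap.ext fun e => ?_)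
        have h : k.unop.unop ≤ l.unop.unop := f.unop.unop.le
        exact (congrArg (I.extToTorsionCohomology a _ n)
          ((projectiveResolution _).extLinearEquiv_naturality Y (projectiveResolution _)
            (powProj a h) n e)).trans (I.extToTorsionCohomology_naturality a h n _) }

/-- The comparison map from local cohomology to `Hⁿ(Γ_a(I))`. -/
noncomputable def localCohomologyHom (n : ℕ) :
    (localCohomology a n).obj Y ⟶ ModuleCat.of R (I.torsionCohomology a n) :=
  (localCohomology.evaluatedCoconeIsColimit a Y n).desc (I.torsionCocone a n)

lemma localCohomologyHom_fac (n : ℕ) (k : ℕᵒᵖᵒᵖ)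
    (e : (localCohomology.evaluatedDiagram a Y n).obj k) :
    I.localCohomologyHom a n ((localCohomology.evaluatedCocone a Y n).ι.app k e) =
      I.extDiagramLeg a n k.unop.unop e :=
  congr($((localCohomology.evaluatedCoconeIsColimit a Y n).fac (I.torsionCocone a n) k).hom e)

lemma localCohomologyHom_bijective (n : ℕ) : Function.Bijective (I.localCohomologyHom a n) := by
  constructor
  · rw [injective_iff_map_eq_zero]
    intro x hx
    obtain ⟨k, e, rfl⟩ := Concrete.isColimit_exists_rep _
      (localCohomology.evaluatedCoconeIsColimit a Y n) x
    have hx' := (I.localCohomologyHom_fac a n k e).symm.trans hx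
    obtain ⟨l, h, hl⟩ := I.extToTorsionCohomology_eq_zero a hx'
    let f : k ⟶ op (op l) := (homOfLE (h : k.unop.unop ≤ l)).op.op
    have hf : (localCohomology.evaluatedDiagram a Y n).map f e = 0 :=
      ((projectiveResolution _).extLinearEquiv Y n).injective
        ((((projectiveResolution _).extLinearEquiv_naturality Y (projectiveResolution _)
            (powProj a h) n e).trans hl).trans (map_zero _).symm)
    rw [← (localCohomology.evaluatedCocone a Y n).w f, ModuleCat.comp_apply, hf, map_zero]
    rfl
  · intro y
    obtain ⟨k, e, rfl⟩ := I.extToTorsionCohomology_exists_rep a n y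
    obtain ⟨e, rfl⟩ := ((projectiveResolution _).extLinearEquiv Y n).surjective e
    exact ⟨_, I.localCohomologyHom_fac a n (op (op k)) e⟩

/-- Local cohomology is computed by the torsion of an injective resolution. -/
noncomputable def localCohomologyEquiv (n : ℕ) :
    (localCohomology a n).obj Y ≃ₗ[R] I.torsionCohomology a n :=
  LinearEquiv.ofBijective (I.localCohomologyHom a n).hom (I.localCohomologyHom_bijective a n)

end CategoryTheory.InjectiveResolution

lemma Ideal.baer_powTorsion {R : Type*} [CommRing R] [IsNoetherianRing R] (a : Ideal R)
    {Q : Type*} [AddCommGroup Q] [Module R Q] (hQ : Module.Baer R Q) :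
    Module.Baer R (a.powTorsion Q) := by
  intro J g
  obtain ⟨k, hk⟩ : ∃ k, ∀ x, ∀ r ∈ a ^ k, r • g x = 0 := by
    obtain ⟨S, hS⟩ := Module.Finite.fg_top (R := R) (M := J)
    choose k hk using fun x => Ideal.mem_powTorsion.1 (g x).2
    refine ⟨S.sup k, fun x r hr => ?_⟩
    have hx : x ∈ Submodule.span R (S : Set J) := hS ▸ Submodule.mem_top
    induction hx using Submodule.span_induction with
    | mem x hx =>
      exact Subtype.ext (hk x r (Ideal.pow_le_pow_right (Finset.le_sup (f := k) hx) hr))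
    | zero => rw [map_zero, smul_zero]
    | add x y _ _ hx hy => rw [map_add, smul_add, hx, hy, add_zero]
    | smul c x _ hx => rw [map_smul, smul_comm, hx, smul_zero]
  obtain ⟨c, hc⟩ := a.exists_pow_inf_eq_pow_smul (J : Submodule R R)
  let n := c + k
  let φ : J →ₗ[R] R ⧸ a ^ n := (a ^ n).mkQ ∘ₗ J.subtype
  have hφ : LinearMap.ker φ ≤ LinearMap.ker ((a.powTorsion Q).subtype ∘ₗ g) := by
    intro x hx
    have h1 : (x : R) ∈ a ^ n • (⊤ : Submodule R R) ⊓ J :=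
      ⟨by simpa using (Submodule.Quotient.mk_eq_zero _).1 hx, x.2⟩
    have h2 : (x : R) ∈ a ^ k • J := by
      rw [hc n (Nat.le_add_right c k), Nat.add_sub_cancel_left] at h1
      exact Submodule.smul_mono le_rfl inf_le_right h1
    have h3 : x ∈ a ^ k • (⊤ : Submodule R J) := by
      have : a ^ k • J = (a ^ k • (⊤ : Submodule R J)).map J.subtype := by
        rw [Submodule.map_smul'', Submodule.map_top, Submodule.range_subtype]
      rw [this] at h2
      obtain ⟨y, hy, hxy⟩ := h2
      rwa [← Subtype.ext hxy]
    refine Submodule.smul_le.2 ?_ h3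
    intro r hr y _
    simpa using congr(Subtype.val $(hk y r hr))
  obtain ⟨h, hh⟩ := hQ.extension_property ((LinearMap.ker φ).liftQ φ le_rfl)
    (LinearMap.ker_eq_bot.1 (Submodule.ker_liftQ_eq_bot _ _ _ le_rfl))
    ((LinearMap.ker φ).liftQ _ hφ)
  refine ⟨(h ∘ₗ (a ^ n).mkQ).codRestrict _ fun x =>
    Ideal.map_quotient_mem_powTorsion le_rfl h _, ?_⟩
  intro x hx
  exact Subtype.ext congr($hh (Submodule.Quotient.mk ⟨x, hx⟩))

instance Ideal.injective_powTorsion {R : Type} [CommRing R] [IsNoetherianRing R] (a : Ideal R)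
    (Q : ModuleCat.{0} R) [Injective Q] : Injective (ModuleCat.of R (a.powTorsion Q)) := by
  have : Injective (ModuleCat.of R Q) := ‹Injective Q›
  have hQ := Module.injective_module_of_injective_object R Q
  have := (a.baer_powTorsion (Module.Baer.of_injective hQ)).injective
  exact Module.injective_object_of_injective_module R _

namespace WeaklyLaskerian

section

variable {R A B C : Type*} [CommRing R] [AddCommGroup A] [Module R A] [AddCommGroup B]
  [Module R B] [AddCommGroup C] [Module R C]

lemma associatedPrimes_finite (h : WeaklyLaskerian R A) : (associatedPrimes R A).Finite :=
  LinearEquiv.AssociatedPrimes.eq (Submodule.quotEquivOfEqBot (⊥ : Submodule R A) rfl) ▸ h ⊥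

lemma of_surjective (h : WeaklyLaskerian R A) (f : A →ₗ[R] B) (hf : Function.Surjective f) :
    WeaklyLaskerian R B := fun K =>
  LinearEquiv.AssociatedPrimes.eq
    ((K.mkQ ∘ₗ f).quotKerEquivOfSurjective (K.mkQ_surjective.comp hf)) ▸ h _

lemma of_exact (hA : WeaklyLaskerian R A) (hC : WeaklyLaskerian R C) (f : A →ₗ[R] B)
    (g : B →ₗ[R] C) (hfg : Function.Exact f g) : WeaklyLaskerian R B := by
  intro N
  let f' := (N.comap f).mapQ N f le_rfl
  let g' := N.mapQ (N.map g) g (Submodule.le_comap_map g N)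
  have hf' : Function.Injective f' := by
    rw [← LinearMap.ker_eq_bot]
    exact Submodule.ker_liftQ_eq_bot _ _ _ (by
      intro x hx
      exact (Submodule.Quotient.mk_eq_zero N).1 hx)
  have hfg' : Function.Exact f' g' := by
    intro y
    obtain ⟨y, rfl⟩ := Submodule.Quotient.mk_surjective _ y
    constructor
    · intro hy
      obtain ⟨n, hn, hny⟩ := (Submodule.Quotient.mk_eq_zero (N.map g)).1 hy
      obtain ⟨x, hx⟩ := (hfg (y - n)).1 (by rw [map_sub, hny, sub_self])
      refine ⟨Submodule.Quotient.mk x, ?_⟩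
      refine (Submodule.Quotient.eq N).2 ?_
      rw [hx, sub_sub_cancel_left]
      exact N.neg_mem hn
    · rintro ⟨x, hx⟩
      obtain ⟨x, rfl⟩ := Submodule.Quotient.mk_surjective _ x
      rw [← hx]
      exact (Submodule.Quotient.mk_eq_zero _).2 (by rw [hfg.apply_apply_eq_zero]; exact zero_mem _)
  exact ((hA _).union (hC _)).subset (associatedPrimes.subset_union_of_exact hf' hfg')

lemma of_subsingleton [Subsingleton A] : WeaklyLaskerian R A := fun _ => by
  rw [associatedPrimes.eq_empty_of_subsingleton]
  exact Set.finite_empty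

lemma of_injective (hB : WeaklyLaskerian R B) (f : A →ₗ[R] B) (hf : Function.Injective f) :
    WeaklyLaskerian R A :=
  of_exact (of_subsingleton (A := PUnit)) hB (0 : PUnit →ₗ[R] A) f fun x => by
    rw [map_eq_zero_iff f hf]
    simp [eq_comm]

lemma pi_fin (h : WeaklyLaskerian R A) (n : ℕ) : WeaklyLaskerian R (Fin n → A) := by
  induction n with
  | zero => exact of_subsingleton
  | succ n ih =>
    refine of_exact h ih (LinearMap.single R (fun _ => A) 0) (LinearMap.funLeft R A Fin.succ) ?_
    intro x
    constructor
    · intro hx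
      refine ⟨x 0, funext fun i => ?_⟩
      refine Fin.cases (by simp) (fun i => ?_) i
      simpa using congr_fun hx.symm i
    · rintro ⟨y, rfl⟩
      ext i
      simp [LinearMap.funLeft]

lemma linearMap [Module.Finite R A] (h : WeaklyLaskerian R B) : WeaklyLaskerian R (A →ₗ[R] B) := by
  obtain ⟨n, f, hf⟩ := Module.Finite.exists_fin' R A
  refine (h.pi_fin n).of_injective
    (LinearMap.pi fun i => LinearMap.applyₗ (f (Pi.single i 1))) ?_
  intro φ ψ hφψ
  refine (LinearMap.cancel_right hf).1 (LinearMap.pi_ext' fun i => LinearMap.ext_ring ?_)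
  exact congr_fun hφψ i

end

lemma ext {R : Type} [CommRing R] [IsNoetherianRing R] {N : ModuleCat.{0} R}
    (h : WeaklyLaskerian R N) (X : ModuleCat.{0} R) [Module.Finite R X] (i : ℕ) :
    WeaklyLaskerian R (Abelian.Ext X N i) := by
  induction i generalizing X with
  | zero =>
    exact (h.linearMap (A := X)).of_surjective _
      (Abelian.Ext.linearEquiv₀.trans ModuleCat.homLinearEquiv).symm.surjective
  | succ n ih =>
    obtain ⟨F, _, _, _, _, f, hf⟩ := Module.exists_finite_presentation R X
    let hS := LinearMap.shortExact_shortComplexKer hf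
    exact (ih _).of_surjective (hS.extClass.precompOfLinear R N (add_comm 1 n))
      (precomp_extClass_surjective_of_projective_X₂ N hS n)

section

variable {R A E Q : Type*} [CommRing R] [AddCommGroup A] [Module R A] [AddCommGroup E]
  [Module R E] [AddCommGroup Q] [Module R Q]

lemma of_ker_le (h : WeaklyLaskerian R E) (s : A →ₗ[R] E) (q : A →ₗ[R] Q)
    (hq : Function.Surjective q) (hsq : LinearMap.ker s ≤ LinearMap.ker q) :
    WeaklyLaskerian R Q := by
  refine (h.of_injective (LinearMap.range s).subtype Subtype.val_injective).of_surjective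
    (s.rangeRestrict.descend s.surjective_rangeRestrict q ?_) ?_
  · rwa [LinearMap.ker_rangeRestrict]
  · intro y
    obtain ⟨x, rfl⟩ := hq y
    exact ⟨_, LinearMap.descend_apply _ _ _ _ x⟩

end

section ShortExact

variable {R : Type} [CommRing R] {S : ShortComplex (ModuleCat.{0} R)}

lemma ext_X₂ (hS : S.ShortExact) (X : ModuleCat.{0} R) {n : ℕ}
    (h₁ : WeaklyLaskerian R (Abelian.Ext X S.X₁ n))
    (h₃ : WeaklyLaskerian R (Abelian.Ext X S.X₃ n)) :
    WeaklyLaskerian R (Abelian.Ext X S.X₂ n) :=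
  of_exact h₁ h₃ ((Abelian.Ext.mk₀ S.f).postcompOfLinear R X (add_zero n))
    ((Abelian.Ext.mk₀ S.g).postcompOfLinear R X (add_zero n)) fun x =>
    ⟨fun hx => Abelian.Ext.covariant_sequence_exact₂ X hS x hx, by
      rintro ⟨y, rfl⟩
      change (y.comp (Abelian.Ext.mk₀ S.f) (add_zero _)).comp (Abelian.Ext.mk₀ S.g) (add_zero _) = 0
      rw [Abelian.Ext.comp_assoc_of_third_deg_zero, Abelian.Ext.mk₀_comp_mk₀, S.zero,
        Abelian.Ext.mk₀_zero, Abelian.Ext.comp_zero]⟩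

lemma ext_X₃_of_range (hS : S.ShortExact) (X : ModuleCat.{0} R) {n : ℕ}
    (h₂ : WeaklyLaskerian R (LinearMap.range
      ((Abelian.Ext.mk₀ S.g).postcompOfLinear R X (add_zero n))))
    (h₁ : WeaklyLaskerian R (Abelian.Ext X S.X₁ (n + 1))) :
    WeaklyLaskerian R (Abelian.Ext X S.X₃ n) :=
  of_exact h₂ h₁ (Submodule.subtype _) (hS.extClass.postcompOfLinear R X rfl) fun x =>
    ⟨fun hx => by
      obtain ⟨y, hy⟩ := Abelian.Ext.covariant_sequence_exact₃ X hS x rfl hx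
      exact ⟨⟨x, y, hy⟩, rfl⟩, by
      rintro ⟨⟨_, y, rfl⟩, rfl⟩
      change (y.comp (Abelian.Ext.mk₀ S.g) (add_zero _)).comp hS.extClass rfl = 0
      rw [Abelian.Ext.comp_assoc_of_second_deg_zero, hS.comp_extClass, Abelian.Ext.comp_zero]⟩

lemma ext_X₃ (hS : S.ShortExact) (X : ModuleCat.{0} R) {n : ℕ}
    (h₂ : WeaklyLaskerian R (Abelian.Ext X S.X₂ n))
    (h₁ : WeaklyLaskerian R (Abelian.Ext X S.X₁ (n + 1))) :
    WeaklyLaskerian R (Abelian.Ext X S.X₃ n) :=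
  ext_X₃_of_range hS X (h₂.of_surjective _ (LinearMap.surjective_rangeRestrict _)) h₁

end ShortExact

end WeaklyLaskerian

lemma ModuleCat.shortExact_mk {R : Type*} [Ring R] {A B C : ModuleCat R} (f : A ⟶ B) (g : B ⟶ C)
    (hf : Function.Injective f) (hg : Function.Surjective g) (hfg : Function.Exact f g) :
    (ShortComplex.mk f g (ModuleCat.hom_ext (LinearMap.ext hfg.apply_apply_eq_zero))).ShortExact where
  exact := (ShortComplex.moduleCat_exact_iff _).2 fun x hx => (hfg x).1 hx
  mono_f := (ModuleCat.mono_iff_injective _).2 hf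
  epi_g := (ModuleCat.epi_iff_surjective _).2 hg

namespace CategoryTheory.InjectiveResolution

open Limits

variable {R : Type} [CommRing R] {Y : ModuleCat.{0} R} (I : InjectiveResolution Y)
  (a : Ideal R)

lemma mem_torsionCoboundaries_succ {n : ℕ} {y : I.cocomplex.X (n + 1)} :
    y ∈ I.torsionCoboundaries a (n + 1) ↔
      ∃ x ∈ a.powTorsion (I.cocomplex.X n), (I.cocomplex.d n (n + 1)).hom x = y := by
  unfold torsionCoboundaries
  rw [CochainComplex.prev_nat_succ]
  rfl

lemma torsionCocycles_le (n : ℕ) : I.torsionCocycles a n ≤ a.powTorsion (I.cocomplex.X n) :=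
  inf_le_left

lemma torsionCoboundaries_zero : I.torsionCoboundaries a 0 = ⊥ := by
  rw [torsionCoboundaries, I.cocomplex.shape _ _ (by simp)]
  exact Submodule.map_zero _

/-- `0 → Bⁿ → Zⁿ → Hⁿ → 0` for the complex `Γ_a(I)`. -/
noncomputable abbrev cohomologyShortComplex (n : ℕ) : ShortComplex (ModuleCat.{0} R) where
  X₁ := ModuleCat.of R (I.torsionCoboundaries a n)
  X₂ := ModuleCat.of R (I.torsionCocycles a n)
  X₃ := ModuleCat.of R (I.torsionCohomology a n)
  f := ModuleCat.ofHom (Submodule.inclusion (I.torsionCoboundaries_le a n))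
  g := ModuleCat.ofHom (Submodule.mkQ _)
  zero := ModuleCat.hom_ext <| LinearMap.ext fun x =>
    (Submodule.Quotient.mk_eq_zero _).2 x.2

lemma cohomologyShortComplex_shortExact (n : ℕ) : (I.cohomologyShortComplex a n).ShortExact := by
  refine ModuleCat.shortExact_mk _ _ (Submodule.inclusion_injective (I.torsionCoboundaries_le a n))
    (Submodule.mkQ_surjective _) ?_
  intro x
  constructor
  · intro hx
    exact ⟨⟨x.1, (Submodule.Quotient.mk_eq_zero
      ((I.torsionCoboundaries a n).submoduleOf (I.torsionCocycles a n))).1 hx⟩, rfl⟩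
  · rintro ⟨y, rfl⟩
    exact (Submodule.Quotient.mk_eq_zero _).2 y.2

/-- `0 → Zⁿ → Γ_a(Iⁿ) → Bⁿ⁺¹ → 0`. -/
noncomputable abbrev cocyclesShortComplex (n : ℕ) : ShortComplex (ModuleCat.{0} R) where
  X₁ := ModuleCat.of R (I.torsionCocycles a n)
  X₂ := ModuleCat.of R (a.powTorsion (I.cocomplex.X n))
  X₃ := ModuleCat.of R (I.torsionCoboundaries a (n + 1))
  f := ModuleCat.ofHom (Submodule.inclusion (I.torsionCocycles_le a n))
  g := ModuleCat.ofHom ((I.cocomplex.d n (n + 1)).hom.restrict fun x hx =>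
    (I.mem_torsionCoboundaries_succ a).2 ⟨x, hx, rfl⟩)
  zero := ModuleCat.hom_ext <| LinearMap.ext fun x => Subtype.ext x.2.2

lemma cocyclesShortComplex_shortExact (n : ℕ) : (I.cocyclesShortComplex a n).ShortExact := by
  refine ModuleCat.shortExact_mk _ _ (Submodule.inclusion_injective (I.torsionCocycles_le a n)) ?_ ?_
  · rintro ⟨y, hy⟩
    obtain ⟨x, hx, rfl⟩ := (I.mem_torsionCoboundaries_succ a).1 hy
    exact ⟨⟨x, hx⟩, rfl⟩
  · intro x
    constructor
    · intro hx
      exact ⟨⟨x.1, x.2, congrArg Subtype.val hx⟩, rfl⟩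
    · rintro ⟨y, rfl⟩
      exact Subtype.ext y.2.2

variable [IsNoetherianRing R]

lemma weaklyLaskerian_ext_torsionCoboundaries (X : ModuleCat.{0} R) [Module.Finite R X] (n : ℕ)
    (h : ∀ i < n, WeaklyLaskerian R (I.torsionCohomology a i)) (k : ℕ) :
    WeaklyLaskerian R (Abelian.Ext X (ModuleCat.of R (I.torsionCoboundaries a n)) (k + 1)) := by
  induction n generalizing k with
  | zero =>
    rw [torsionCoboundaries_zero]
    exact WeaklyLaskerian.ext (N := ModuleCat.of R (⊥ : Submodule R (I.cocomplex.X 0)))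
      WeaklyLaskerian.of_subsingleton X _
  | succ n ih =>
    have hB := ih fun i hi => h i (hi.trans n.lt_succ_self)
    have hH : ∀ k, WeaklyLaskerian R
        (Abelian.Ext X (ModuleCat.of R (I.torsionCohomology a n)) k) := fun k =>
      WeaklyLaskerian.ext (N := ModuleCat.of R (I.torsionCohomology a n)) (h n n.lt_succ_self) X k
    have hZ := WeaklyLaskerian.ext_X₂ (I.cohomologyShortComplex_shortExact a n) X (hB (k + 1))
      (hH (k + 2))
    have : Subsingleton (Abelian.Ext X (I.cocyclesShortComplex a n).X₂ (k + 1)) :=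
      subsingleton_of_forall_eq 0 fun e => e.eq_zero_of_injective
    exact WeaklyLaskerian.ext_X₃ (I.cocyclesShortComplex_shortExact a n) X
      WeaklyLaskerian.of_subsingleton hZ

end CategoryTheory.InjectiveResolution

lemma associatedPrimes_subset_linearMap_quotient {R : Type*} [CommRing R] [IsNoetherianRing R]
    (a : Ideal R) {N : Type*} [AddCommGroup N] [Module R N] (h : a.powTorsion N = ⊤) :
    associatedPrimes R N ⊆ associatedPrimes R ((R ⧸ a) →ₗ[R] N) := by
  intro p hp
  obtain ⟨hp, x, hx⟩ := isAssociatedPrime_iff.1 hp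
  have hpx : ∀ r, r ∈ p ↔ r • x = 0 := fun r => by
    rw [hx, Submodule.mem_colon_singleton, Submodule.mem_bot]
  obtain ⟨k, hk⟩ := Ideal.mem_powTorsion.1 (h ▸ Submodule.mem_top : x ∈ a.powTorsion N)
  have hap : a ≤ p := fun r hr =>
    hp.mem_of_pow_mem k ((hpx _).2 (hk _ (Ideal.pow_mem_pow hr k)))
  have hax : ∀ r ∈ a, r • x = 0 := fun r hr => (hpx r).1 (hap hr)
  have hf := a.quotientToSpanSingleton_one x hax
  refine isAssociatedPrime_iff.2 ⟨hp, a.quotientToSpanSingleton x hax, ?_⟩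
  ext r
  rw [hpx, Submodule.mem_colon_singleton, Submodule.mem_bot]
  constructor
  · intro hr
    exact Ideal.quotient_linearMap_ext (by rw [LinearMap.smul_apply, hf, hr, LinearMap.zero_apply])
  · intro hr
    rw [← hf, ← LinearMap.smul_apply, hr, LinearMap.zero_apply]

namespace CategoryTheory.InjectiveResolution

open Limits

variable {R : Type} [CommRing R] {Y : ModuleCat.{0} R} (I : InjectiveResolution Y)
  (a : Ideal R)

lemma powTorsion_torsionCohomology (n : ℕ) : a.powTorsion (I.torsionCohomology a n) = ⊤ := by
  refine eq_top_iff.2 fun x _ => ?_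
  obtain ⟨⟨x, ⟨k, hk⟩, hx⟩, rfl⟩ := Submodule.Quotient.mk_surjective _ x
  exact Ideal.map_mem_powTorsion (Submodule.mkQ _) ⟨k, fun r hr => Subtype.ext (hk r hr)⟩

/-- A cocycle of `Hom(R ⧸ a, I)` takes values in the cocycles of `Γ_a(I)`. -/
def homCocyclesToTorsion (n : ℕ) : I.homCocycles (ModuleCat.of R (R ⧸ a)) n →ₗ[R]
    (ModuleCat.of R (R ⧸ a) ⟶ ModuleCat.of R (I.torsionCocycles a n)) where
  toFun f := ModuleCat.ofHom (f.1.hom.codRestrict _ fun x =>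
    ⟨Ideal.map_quotient_mem_powTorsion (pow_one a).le f.1.hom x, congr($(f.2).hom x)⟩)
  map_add' _ _ := rfl
  map_smul' _ _ := rfl

lemma homCocyclesToTorsion_surjective (n : ℕ) :
    Function.Surjective (I.homCocyclesToTorsion a n) := fun f =>
  ⟨⟨f ≫ ModuleCat.ofHom (Submodule.subtype _),
    ModuleCat.hom_ext (LinearMap.ext fun x => (f.hom x).2.2)⟩, rfl⟩

/-- Maps into the coboundaries of `Γ_a(I)` are cocycles of `Hom(X, I)`. -/
noncomputable def homTorsionCoboundariesToCocycles (X : ModuleCat.{0} R) (n : ℕ) :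
    (X ⟶ ModuleCat.of R (I.torsionCoboundaries a n)) →ₗ[R] I.homCocycles X n where
  toFun f := ⟨f ≫ ModuleCat.ofHom (Submodule.subtype _), ModuleCat.hom_ext (LinearMap.ext fun x =>
    (I.torsionCoboundaries_le a n (f.hom x).2).2)⟩
  map_add' _ _ := rfl
  map_smul' _ _ := rfl

variable [IsNoetherianRing R]

lemma weaklyLaskerian_ext_zero_torsionCohomology (hY : WeaklyLaskerian R Y) (t : ℕ)
    (h : ∀ i < t, WeaklyLaskerian R (I.torsionCohomology a i)) :
    WeaklyLaskerian R (Abelian.Ext (ModuleCat.of R (R ⧸ a))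
      (ModuleCat.of R (I.torsionCohomology a t)) 0) := by
  let X := ModuleCat.of R (R ⧸ a)
  let ψ := (Abelian.Ext.mk₀ (I.cohomologyShortComplex a t).g).postcompOfLinear R X (add_zero 0)
  let e := (Abelian.Ext.linearEquiv₀ (R := R) (X := X)
    (Y := ModuleCat.of R (I.torsionCocycles a t))).symm
  have hs : Function.Surjective (e.toLinearMap ∘ₗ I.homCocyclesToTorsion a t) :=
    e.surjective.comp (I.homCocyclesToTorsion_surjective a t)
  refine WeaklyLaskerian.ext_X₃_of_range (I.cohomologyShortComplex_shortExact a t) X ?_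
    (I.weaklyLaskerian_ext_torsionCoboundaries a X t h 0)
  refine (hY.ext X t).of_ker_le (I.homCocyclesToExt X t)
    (ψ.rangeRestrict ∘ₗ (e.toLinearMap ∘ₗ I.homCocyclesToTorsion a t))
    (ψ.surjective_rangeRestrict.comp hs) ?_
  intro f hf
  obtain ⟨g, hg⟩ := (I.homCocyclesToExt_eq_zero_iff f).1 hf
  refine Subtype.ext ?_
  change (Abelian.Ext.mk₀ (I.homCocyclesToTorsion a t f)).comp
    (Abelian.Ext.mk₀ (I.cohomologyShortComplex a t).g) (add_zero 0) = 0
  rw [Abelian.Ext.mk₀_comp_mk₀]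
  have : I.homCocyclesToTorsion a t f ≫ (I.cohomologyShortComplex a t).g = 0 := by
    refine ModuleCat.hom_ext (LinearMap.ext fun x => ?_)
    exact (Submodule.Quotient.mk_eq_zero _).2
      ⟨g.hom x, Ideal.map_quotient_mem_powTorsion (pow_one a).le g.hom x, congr($(hg).hom x)⟩
  rw [this, Abelian.Ext.mk₀_zero]

lemma weaklyLaskerian_ext_one_torsionCohomology (hY : WeaklyLaskerian R Y) (t : ℕ)
    (h : ∀ i < t, WeaklyLaskerian R (I.torsionCohomology a i)) :
    WeaklyLaskerian R (Abelian.Ext (ModuleCat.of R (R ⧸ a))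
      (ModuleCat.of R (I.torsionCohomology a t)) 1) := by
  let X := ModuleCat.of R (R ⧸ a)
  let hS := I.cocyclesShortComplex_shortExact a t
  refine WeaklyLaskerian.ext_X₃ (I.cohomologyShortComplex_shortExact a t) X ?_
    (I.weaklyLaskerian_ext_torsionCoboundaries a X t h 1)
  let δ := hS.extClass.postcompOfLinear R X (zero_add 1)
  let e := (Abelian.Ext.linearEquiv₀ (R := R) (X := X)
    (Y := (I.cocyclesShortComplex a t).X₃)).symm
  have hδ : Function.Surjective δ := fun x =>
    Abelian.Ext.covariant_sequence_exact₁ X hS x (Abelian.Ext.eq_zero_of_injective _) rfl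
  refine (hY.ext X (t + 1)).of_ker_le
    (I.homCocyclesToExt X (t + 1) ∘ₗ I.homTorsionCoboundariesToCocycles a X (t + 1))
    (δ ∘ₗ e.toLinearMap) (hδ.comp e.surjective) ?_
  intro f hf
  obtain ⟨g, hg⟩ := (I.extMk_eq_zero_iff (I.homTorsionCoboundariesToCocycles a X (t + 1) f).1 _ rfl
    (I.homTorsionCoboundariesToCocycles a X (t + 1) f).2 t rfl).1 hf
  let g' : X ⟶ (I.cocyclesShortComplex a t).X₂ := ModuleCat.ofHom
    (g.hom.codRestrict _ fun x => Ideal.map_quotient_mem_powTorsion (pow_one a).le g.hom x)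
  have hf' : f = g' ≫ (I.cocyclesShortComplex a t).g :=
    ModuleCat.hom_ext (LinearMap.ext fun x => Subtype.ext congr($(hg.symm).hom x))
  change (Abelian.Ext.mk₀ f).comp hS.extClass (zero_add 1) = 0
  rw [hf', ← Abelian.Ext.mk₀_comp_mk₀, Abelian.Ext.comp_assoc_of_second_deg_zero,
    hS.comp_extClass, Abelian.Ext.comp_zero]

end CategoryTheory.InjectiveResolution

/-- If `M` is weakly Laskerian and `H_a^i(M)` is weakly Laskerian for all
`i < t`, then `Ass H_a^t(M)` and `Ass Ext^1(R/a, H_a^t(M))` are finite. -/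
theorem associatedPrimes_finite_of_weaklyLaskerian_below
    {R : Type} [CommRing R] [IsNoetherianRing R] (a : Ideal R)
    (M : Type) [AddCommGroup M] [Module R M] (hM : WeaklyLaskerian R M) (t : ℕ)
    (hw : ∀ i < t, WeaklyLaskerian R ((localCohomology a i).obj (ModuleCat.of R M))) :
    (associatedPrimes R ((localCohomology a t).obj (ModuleCat.of R M))).Finite ∧
      (associatedPrimes R
        (extMod a 1 ((localCohomology a t).obj (ModuleCat.of R M)))).Finite := by
  let I := injectiveResolution (ModuleCat.of R M)
  let X := ModuleCat.of R (R ⧸ a)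
  let H := (localCohomology a t).obj (ModuleCat.of R M)
  let φ := I.localCohomologyEquiv a t
  have hH : ∀ i < t, WeaklyLaskerian R (I.torsionCohomology a i) := fun i hi =>
    (hw i hi).of_surjective _ (I.localCohomologyEquiv a i).surjective
  have h₀ := I.weaklyLaskerian_ext_zero_torsionCohomology a hM t hH
  have h₁ := I.weaklyLaskerian_ext_one_torsionCohomology a hM t hH
  constructor
  · have h₀' := h₀.of_surjective _
      (Abelian.Ext.linearEquiv₀.trans ModuleCat.homLinearEquiv).surjective
    rw [LinearEquiv.AssociatedPrimes.eq φ]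
    exact h₀'.associatedPrimes_finite.subset
      (associatedPrimes_subset_linearMap_quotient a (I.powTorsion_torsionCohomology a t))
  · have e : extMod a 1 H ≃ₗ[R] Abelian.Ext X H 1 :=
      (projectiveResolution X).extLinearEquiv H 1
    let i : ModuleCat.of R (I.torsionCohomology a t) ≅ H := φ.symm.toModuleIso
    rw [LinearEquiv.AssociatedPrimes.eq e]
    refine (h₁.of_surjective
      ((Abelian.Ext.mk₀ i.hom).postcompOfLinear R X (add_zero 1)) fun x => ?_
      ).associatedPrimes_finite
    refine ⟨x.comp (Abelian.Ext.mk₀ i.inv) (add_zero 1), ?_⟩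
    change (x.comp (Abelian.Ext.mk₀ i.inv) (add_zero 1)).comp (Abelian.Ext.mk₀ i.hom) (add_zero 1) = x
    rw [Abelian.Ext.comp_assoc_of_third_deg_zero, Abelian.Ext.mk₀_comp_mk₀, i.inv_hom_id,
      Abelian.Ext.comp_mk₀_id]
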